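/- Let m, m₁ ≥ 2 with m₁ not dividing m, let τ ∈ L_{m₁}, and let ζ be an α-sequence such that g = τ_o ζ ∈ L_m, g is not the least element of L_m, and ĝ = τ_e ζ is lexical. Then g_o ĝ ∈ L_{2m}. -/

import Mathlib

/-!
Common definitions: α-sequences, the lexical order, elementary operations,
lexical sequences, harmonics, star products, etc.
-/

/-- The sign-alternating sequence `Al(τ)` associated to an α-sequence `τ`
(0-indexed: entry `i` of `Al τ` is `(-1)^i * τ_{i+1}`, and `0` beyond the length). -/
def Al (τ : List ℕ) (i : ℕ) : ℤ := (-1 : ℤ) ^ i * (τ.getD i 0 : ℤ)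

/-- The (strict) lexical order: `τ < τ'` iff the first nonzero entry of
`Al τ - Al τ'` is negative. -/
def lexLt (τ τ' : List ℕ) : Prop :=
  ∃ i, (∀ j < i, Al τ j = Al τ' j) ∧ Al τ i < Al τ' i

/-- An α-sequence: a nonempty finite sequence of positive integers. -/
def IsAlphaSeq (α : List ℕ) : Prop := α ≠ [] ∧ ∀ x ∈ α, 0 < x

/-- `Aset n` is the set `A_n` of α-sequences of degree `n`. -/
def Aset (n : ℕ) : Set (List ℕ) := {α | IsAlphaSeq α ∧ α.sum = n}

/-- Splitting operation `E_s` at the (1-indexed) cell `i`: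
`(α₁,…,α_{i-1}, α_i - 1, 1, α_{i+1},…,α_k)`. -/
def applyEs (α : List ℕ) (i : ℕ) : List ℕ :=
  α.take (i - 1) ++ [α.getD (i - 1) 0 - 1, 1] ++ α.drop i

/-- `E_s` is applicable at cell `i` iff `1 ≤ i ≤ l(α)` and `α_i > 1`. -/
def EsApplicable (α : List ℕ) (i : ℕ) : Prop :=
  1 ≤ i ∧ i ≤ α.length ∧ 1 < α.getD (i - 1) 0

/-- Conjugation operation `E_c` at the (1-indexed) cell `i`:
`(α₁,…,α_{i-2}, α_{i-1} + 1, α_{i+1},…,α_k)`. -/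
def applyEc (α : List ℕ) (i : ℕ) : List ℕ :=
  α.take (i - 2) ++ [α.getD (i - 2) 0 + 1] ++ α.drop i

/-- `E_c` is applicable at cell `i` iff `2 ≤ i ≤ l(α)` and `α_i = 1`. -/
def EcApplicable (α : List ℕ) (i : ℕ) : Prop :=
  2 ≤ i ∧ i ≤ α.length ∧ α.getD (i - 1) 0 = 1

/-- `α'` is obtained from `α` by applying one elementary operation (`E_s` or `E_c`)
at the (1-indexed) cell `i`. -/
def ElemOpAt (α : List ℕ) (i : ℕ) (α' : List ℕ) : Prop :=
  (EsApplicable α i ∧ α' = applyEs α i) ∨ (EcApplicable α i ∧ α' = applyEc α i)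

/-- `a < b` and `a`, `b` are adjacent in `S`: no element of `S` lies strictly between. -/
def AdjLtIn (S : Set (List ℕ)) (a b : List ℕ) : Prop :=
  lexLt a b ∧ ∀ γ ∈ S, ¬ (lexLt a γ ∧ lexLt γ b)

/-- An α-sequence is lexical iff it strictly exceeds all of its proper right sequences. -/
def IsLexical (α : List ℕ) : Prop :=
  IsAlphaSeq α ∧ ∀ i, 2 ≤ i → i ≤ α.length → lexLt (α.drop (i - 1)) α

/-- `Lset n` is the set `L_n` of lexical sequences `α` with `1 + D(α) = n`. -/
def Lset (n : ℕ) : Set (List ℕ) := {α | IsLexical α ∧ 1 + α.sum = n}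

/-- Add `1` to the last entry of a list. -/
def bumpLast (α : List ℕ) : List ℕ := α.dropLast ++ [α.getD (α.length - 1) 0 + 1]

/-- `α_e`: the even-length modification of `α`. -/
def seqE (α : List ℕ) : List ℕ := if Even α.length then bumpLast α else α ++ [1]

/-- `α_o`: the odd-length modification of `α`. -/
def seqO (α : List ℕ) : List ℕ := if Even α.length then α ++ [1] else bumpLast α

/-- The `j`-th harmonicSeq: `h_0(α) = α` and `h_j(α) = (h_{j-1}(α))_o h_{j-1}(α)`. -/
def harmonicSeq : ℕ → List ℕ → List ℕ
  | 0, α => α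
  | j + 1, α => seqO (harmonicSeq j α) ++ harmonicSeq j α

/-- A sequence is fundamental iff it is not a harmonicSeq `h_j(β)`, `j ≥ 1`,
of any α-sequence `β`. -/
def IsFundamental (α : List ℕ) : Prop :=
  ∀ β : List ℕ, IsAlphaSeq β → ∀ j, 1 ≤ j → α ≠ harmonicSeq j β

/-- `α^q`: the `q`-fold concatenation of `α` with itself. -/
def nrep (α : List ℕ) (q : ℕ) : List ℕ := (List.replicate q α).flatten

/-- The star product
`α ⋆ β = α_o (α_e)^{β₁-1} α_o (α_e)^{β₂-1} ⋯ α_o (α_e)^{β_k-1} α`. -/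
def starProd (α β : List ℕ) : List ℕ :=
  (β.map (fun b => seqO α ++ nrep (seqE α) (b - 1))).flatten ++ α

/-- `α ∧ β`: the longest common left factor, ended by the minimum of the
first differing entries. -/
def wedge : List ℕ → List ℕ → List ℕ
  | [], _ => []
  | _, [] => []
  | a :: as, b :: bs => if a = b then a :: wedge as bs else [min a b]

/-- `a` is the least element of `S` in the lexical order. -/
def LeastIn (S : Set (List ℕ)) (a : List ℕ) : Prop :=
  a ∈ S ∧ ∀ b ∈ S, b ≠ a → lexLt a b

/-- `a` is the greatest element of `S` in the lexical order. -/
def GreatestIn (S : Set (List ℕ)) (a : List ℕ) : Prop :=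
  a ∈ S ∧ ∀ b ∈ S, b ≠ a → lexLt b a

/-- `i` is an even (1-indexed) cell of `α` at which the applicable elementary
operation yields a lexical sequence. -/
def GoodEvenIndex (α : List ℕ) (i : ℕ) : Prop :=
  Even i ∧ ∃ α', ElemOpAt α i α' ∧ IsLexical α'

/-- `i` is an odd (1-indexed) cell of `α` at which the applicable elementary
operation yields a lexical sequence. -/
def GoodOddIndex (α : List ℕ) (i : ℕ) : Prop :=
  Odd i ∧ ∃ α', ElemOpAt α i α' ∧ IsLexical α'

/-- The successor operation: apply whichever of `E_s`, `E_c` is applicable at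
the largest even (1-indexed) index `≤ l(α)`, i.e. on the tail of the longest
left sequence of even length. -/
def succOp (α : List ℕ) : List ℕ :=
  let i := if Even α.length then α.length else α.length - 1
  if 1 < α.getD (i - 1) 0 then applyEs α i else applyEc α i

lemma bumpLast_cons (a : ℕ) {x : List ℕ} (hx : x ≠ []) :
    bumpLast (a :: x) = a :: bumpLast x := by
  obtain ⟨b, y, rfl⟩ := List.exists_cons_of_ne_nil hx
  simp [bumpLast]

@[simp] lemma seqO_nil : seqO [] = [1] := by simp [seqO]

@[simp] lemma seqO_singleton (a : ℕ) : seqO [a] = [a + 1] := by simp [seqO, bumpLast]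

@[simp] lemma seqE_cons (a : ℕ) (x : List ℕ) : seqE (a :: x) = a :: seqO x := by
  rcases eq_or_ne x [] with rfl | hx
  · simp [seqE]
  · by_cases h : Even x.length <;>
      simp [seqE, seqO, h, Nat.even_add_one, bumpLast_cons a hx]

lemma seqO_cons (a : ℕ) {x : List ℕ} (hx : x ≠ []) : seqO (a :: x) = a :: seqE x := by
  by_cases h : Even x.length <;>
    simp [seqE, seqO, h, Nat.even_add_one, bumpLast_cons a hx]

lemma seqO_append (x y : List ℕ) (h : y ≠ [] ∨ Even x.length) :
    (seqO (x ++ y) = x ++ if Even x.length then seqO y else seqE y) ∧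
      (y ≠ [] → seqE (x ++ y) = x ++ if Even x.length then seqE y else seqO y) := by
  by_cases hy : y = []
  · subst hy
    have hx : Even x.length := by simpa using h
    simp [seqO, hx]
  · induction x with
    | nil => simp
    | cons a x ih =>
      obtain ⟨h₁, h₂⟩ := ih (Or.inl hy)
      have hne : x ++ y ≠ [] := by simp [hy]
      refine ⟨?_, fun _ => ?_⟩
      · rw [List.cons_append, seqO_cons a hne, h₂ hy]
        by_cases hx : Even x.length <;> simp [hx, Nat.even_add_one]
      · rw [List.cons_append, seqE_cons, h₁]
        by_cases hx : Even x.length <;> simp [hx, Nat.even_add_one]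

lemma seqO_append_of_even {x : List ℕ} (hx : Even x.length) (y : List ℕ) :
    seqO (x ++ y) = x ++ seqO y := by
  simpa [hx] using (seqO_append x y (Or.inr hx)).1

lemma seqO_append_of_odd {x y : List ℕ} (hx : Odd x.length) (hy : y ≠ []) :
    seqO (x ++ y) = x ++ seqE y := by
  simpa [Nat.not_even_iff_odd.2 hx] using (seqO_append x y (Or.inl hy)).1

lemma sum_bumpLast (x : List ℕ) : (bumpLast x).sum = x.sum + 1 := by
  induction x with
  | nil => simp [bumpLast]
  | cons a x ih =>
    rcases eq_or_ne x [] with rfl | hx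
    · simp [bumpLast]
    · rw [bumpLast_cons a hx, List.sum_cons, ih, List.sum_cons, add_assoc]

lemma sum_seqO (x : List ℕ) : (seqO x).sum = x.sum + 1 := by
  unfold seqO
  split_ifs <;> simp [sum_bumpLast]

lemma sum_seqE (x : List ℕ) : (seqE x).sum = x.sum + 1 := by
  unfold seqE
  split_ifs <;> simp [sum_bumpLast]

lemma length_bumpLast {x : List ℕ} (hx : x ≠ []) : (bumpLast x).length = x.length := by
  have := List.length_pos_iff.2 hx
  simp [bumpLast]
  omega

lemma length_seqO_of_even {x : List ℕ} (hx : Even x.length) :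
    (seqO x).length = x.length + 1 := by
  simp [seqO, hx]

lemma length_seqO_of_odd {x : List ℕ} (hx : Odd x.length) : (seqO x).length = x.length := by
  have hne : x ≠ [] := by
    rintro rfl
    simp at hx
  rw [seqO, if_neg (Nat.not_even_iff_odd.2 hx), length_bumpLast hne]

lemma odd_length_seqO (x : List ℕ) : Odd (seqO x).length := by
  rcases Nat.even_or_odd x.length with hx | hx
  · rw [length_seqO_of_even hx]
    exact hx.add_one
  · rwa [length_seqO_of_odd hx]

lemma forall_pos_seqO {x : List ℕ} (hx : ∀ a ∈ x, 0 < a) : ∀ a ∈ seqO x, 0 < a := by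
  intro a ha
  unfold seqO bumpLast at ha
  split_ifs at ha
  · rcases List.mem_append.1 ha with ha | ha
    · exact hx a ha
    · simp_all
  · rcases List.mem_append.1 ha with ha | ha
    · exact hx a (List.mem_of_mem_dropLast ha)
    · simp_all

lemma Al_cons_zero (a : ℕ) (x : List ℕ) : Al (a :: x) 0 = a := by simp [Al]

lemma Al_cons_succ (a : ℕ) (x : List ℕ) (i : ℕ) : Al (a :: x) (i + 1) = -Al x i := by
  simp [Al, pow_succ]

lemma lexLt_cons_cons {a b : ℕ} {x y : List ℕ} :
    lexLt (a :: x) (b :: y) ↔ a < b ∨ a = b ∧ lexLt y x := by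
  constructor
  · rintro ⟨i, h₁, h₂⟩
    cases i with
    | zero => simp only [Al_cons_zero] at h₂; left; exact_mod_cast h₂
    | succ i =>
      right
      have h₀ := h₁ 0 (by omega)
      simp only [Al_cons_zero] at h₀
      refine ⟨by exact_mod_cast h₀, i, fun j hj => ?_, ?_⟩
      · have := h₁ (j + 1) (by omega)
        simp only [Al_cons_succ] at this
        omega
      · simp only [Al_cons_succ] at h₂
        omega
  · rintro (h | ⟨rfl, i, h₁, h₂⟩)
    · exact ⟨0, by simp, by simpa [Al_cons_zero] using h⟩
    · refine ⟨i + 1, fun j hj => ?_, ?_⟩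
      · cases j with
        | zero => simp [Al_cons_zero]
        | succ j => simp [Al_cons_succ, h₁ j (by omega)]
      · simpa [Al_cons_succ] using h₂

lemma lexLt_nil_cons {a : ℕ} (ha : 0 < a) (x : List ℕ) : lexLt [] (a :: x) :=
  ⟨0, by simp, by simpa [Al] using ha⟩

lemma not_lexLt_nil {x : List ℕ} (hx : ∀ a ∈ x, 0 < a) : ¬ lexLt x [] := by
  rintro ⟨i, h₁, h₂⟩
  cases x with
  | nil => simp at h₂
  | cons a x =>
    have ha : 0 < a := hx a (by simp)
    cases i with
    | zero => simp [Al] at h₂; omega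
    | succ i =>
      have := h₁ 0 (by omega)
      simp [Al] at this
      omega

lemma lexLt_trans {x y z : List ℕ} (hxy : lexLt x y) (hyz : lexLt y z) : lexLt x z := by
  obtain ⟨i, hi, hi'⟩ := hxy
  obtain ⟨j, hj, hj'⟩ := hyz
  rcases lt_trichotomy i j with h | rfl | h
  · exact ⟨i, fun k hk => (hi k hk).trans (hj k (hk.trans h)), hj i h ▸ hi'⟩
  · exact ⟨i, fun k hk => (hi k hk).trans (hj k hk), hi'.trans hj'⟩
  · exact ⟨j, fun k hk => (hi k (hk.trans h)).trans (hj k hk), by rw [hi j h]; exact hj'⟩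

lemma lexLt_append_left (p : List ℕ) {x y : List ℕ} :
    (Even p.length → lexLt x y → lexLt (p ++ x) (p ++ y)) ∧
      (Odd p.length → lexLt y x → lexLt (p ++ x) (p ++ y)) := by
  induction p generalizing x y with
  | nil => simp
  | cons a p ih =>
    refine ⟨fun h hxy => ?_, fun h hxy => ?_⟩
    · have hp : Odd p.length := by simpa [Nat.even_add_one] using h
      exact lexLt_cons_cons.2 (Or.inr ⟨rfl, ih.2 hp hxy⟩)
    · have hp : Even p.length := by simpa [Nat.odd_add_one] using h
      exact lexLt_cons_cons.2 (Or.inr ⟨rfl, ih.1 hp hxy⟩)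

/-- Evening out the smaller side, or odding out the larger side, and then extending it
arbitrarily, preserves a strict inequality. -/
lemma lexLt_seqE_append_and_seqO_append {r h : List ℕ} (u : List ℕ) (hr : ∀ a ∈ r, 0 < a)
    (hh : ∀ a ∈ h, 0 < a) :
    (r ≠ [] → lexLt r h → lexLt (seqE r ++ u) h) ∧ (lexLt h r → lexLt h (seqO r ++ u)) := by
  induction r generalizing h with
  | nil => exact ⟨fun h => absurd rfl h, fun hlt => absurd hlt (not_lexLt_nil hh)⟩
  | cons a x ih =>
    have hx : ∀ c ∈ x, 0 < c := fun c hc => hr c (by simp [hc])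
    cases h with
    | nil =>
      refine ⟨fun _ hlt => absurd hlt (not_lexLt_nil hr), fun _ => ?_⟩
      rcases eq_or_ne x [] with rfl | hne
      · simpa using lexLt_nil_cons (Nat.succ_pos a) u
      · rw [seqO_cons a hne]
        exact lexLt_nil_cons (hr a (by simp)) _
    | cons b y =>
      have hy : ∀ c ∈ y, 0 < c := fun c hc => hh c (by simp [hc])
      obtain ⟨ih₁, ih₂⟩ := ih hx hy
      simp only [seqE_cons, List.cons_append, lexLt_cons_cons]
      refine ⟨fun _ hlt => hlt.imp_right fun ⟨hab, hyx⟩ => ⟨hab, ih₂ hyx⟩, fun hlt => ?_⟩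
      rcases eq_or_ne x [] with rfl | hne
      · simp only [seqO_singleton, List.cons_append, List.nil_append, lexLt_cons_cons]
        omega
      · rw [seqO_cons a hne, List.cons_append, lexLt_cons_cons]
        exact hlt.imp_right fun ⟨hab, hxy⟩ => ⟨hab, ih₁ hne hxy⟩

lemma lexLt_seqO_seqO_or_prefix {t g : List ℕ} (u : List ℕ) (ht : ∀ a ∈ t, 0 < a)
    (hg : ∀ a ∈ g, 0 < a) :
    (lexLt t g → lexLt (seqO t ++ u) (seqO g ++ u) ∨ ∃ r, g = seqO t ++ r) ∧
      (g ≠ [] → lexLt g t →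
        lexLt (seqE g ++ u) (seqE t ++ u) ∨ ∃ r, g = seqE t ++ r) := by
  induction t generalizing g with
  | nil =>
    refine ⟨fun hlt => ?_, fun _ hlt => absurd hlt (not_lexLt_nil hg)⟩
    cases g with
    | nil => exact absurd hlt (not_lexLt_nil hg)
    | cons b y =>
      have hb : 0 < b := hg b (by simp)
      rcases eq_or_ne b 1 with rfl | hb1
      · exact Or.inr ⟨y, by simp⟩
      · left
        rcases eq_or_ne y [] with rfl | hy
        · simp only [seqO_nil, seqO_singleton, List.cons_append, lexLt_cons_cons]
          omega
        · simp only [seqO_nil, seqO_cons b hy, List.cons_append, lexLt_cons_cons]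
          omega
  | cons a x ih =>
    have hx : ∀ c ∈ x, 0 < c := fun c hc => ht c (by simp [hc])
    cases g with
    | nil => exact ⟨fun hlt => absurd hlt (not_lexLt_nil ht), fun h => absurd rfl h⟩
    | cons b y =>
      have hy : ∀ c ∈ y, 0 < c := fun c hc => hg c (by simp [hc])
      obtain ⟨ih₁, ih₂⟩ := ih hx hy
      rw [lexLt_cons_cons, lexLt_cons_cons]
      constructor
      · rintro (hab | ⟨rfl, hyx⟩)
        · rcases eq_or_ne x [] with rfl | hxn
          · rcases (Nat.succ_le_of_lt hab).eq_or_lt with rfl | hab'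
            · exact Or.inr ⟨y, by simp⟩
            · left
              rcases eq_or_ne y [] with rfl | hyn
              · simp only [seqO_singleton, List.cons_append, lexLt_cons_cons]
                omega
              · simp only [seqO_singleton, seqO_cons b hyn, List.cons_append, lexLt_cons_cons]
                omega
          · left
            rcases eq_or_ne y [] with rfl | hyn
            · simp only [seqO_singleton, seqO_cons a hxn, List.cons_append, lexLt_cons_cons]
              omega
            · simp only [seqO_cons b hyn, seqO_cons a hxn, List.cons_append, lexLt_cons_cons]
              omega
        · have hxn : x ≠ [] := by
            rintro rfl
            exact not_lexLt_nil hy hyx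
          rcases eq_or_ne y [] with rfl | hyn
          · left
            simp only [seqO_singleton, seqO_cons a hxn, List.cons_append, lexLt_cons_cons]
            omega
          · simpa [seqO_cons a hxn, seqO_cons a hyn, lexLt_cons_cons] using ih₂ hyn hyx
      · rintro - (hab | ⟨rfl, hxy⟩)
        · left
          simp only [seqE_cons, List.cons_append, lexLt_cons_cons]
          omega
        · simpa [lexLt_cons_cons] using ih₁ hxy

lemma lexLt_seqE_seqE_of_length_lt {x y : List ℕ} (u v : List ℕ) (hy : ∀ a ∈ y, 0 < a)
    (hlen : x.length < y.length) :
    (x ≠ [] → lexLt x y → lexLt (seqE x ++ u) (seqE y ++ v)) ∧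
      (lexLt y x → lexLt (seqO y ++ v) (seqO x ++ u)) := by
  induction x generalizing y with
  | nil => exact ⟨fun h => absurd rfl h, fun hlt => absurd hlt (not_lexLt_nil hy)⟩
  | cons a x ih =>
    cases y with
    | nil => simp at hlen
    | cons b y =>
      have hlen' : x.length < y.length := by simpa using hlen
      have hyn : y ≠ [] := List.ne_nil_of_length_pos (by omega)
      obtain ⟨ih₁, ih₂⟩ := ih (fun c hc => hy c (by simp [hc])) hlen'
      simp only [seqE_cons, seqO_cons b hyn, List.cons_append, lexLt_cons_cons]
      refine ⟨fun _ hlt => hlt.imp_right fun ⟨hab, h⟩ => ⟨hab, ih₂ h⟩, fun hlt => ?_⟩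
      rcases eq_or_ne x [] with rfl | hxn
      · simp only [seqO_singleton, List.cons_append, lexLt_cons_cons]
        omega
      · rw [seqO_cons a hxn, List.cons_append, lexLt_cons_cons]
        exact hlt.imp_right fun ⟨hab, h⟩ => ⟨hab, ih₁ hxn h⟩

lemma lexLt_seqE_seqO {x : List ℕ} (hx : x ≠ []) (u v : List ℕ) :
    lexLt (seqE x ++ u) (seqO x ++ v) := by
  induction x generalizing u v with
  | nil => exact absurd rfl hx
  | cons a x ih =>
    rcases eq_or_ne x [] with rfl | hne
    · simp [lexLt_cons_cons]
    · rw [seqE_cons, seqO_cons a hne, List.cons_append, List.cons_append, lexLt_cons_cons]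
      exact Or.inr ⟨rfl, ih hne v u⟩

lemma isLexical_iff {x : List ℕ} :
    IsLexical x ↔ IsAlphaSeq x ∧ ∀ p s, p ≠ [] → s ≠ [] → x = p ++ s → lexLt s x := by
  refine and_congr_right fun _ => ⟨?_, ?_⟩
  · rintro h p s hp hs rfl
    have hp' := List.length_pos_iff.2 hp
    have hs' := List.length_pos_iff.2 hs
    simpa using h (p.length + 1) (by omega) (by rw [List.length_append]; omega)
  · intro h i hi hi'
    refine h (x.take (i - 1)) (x.drop (i - 1)) ?_ ?_ (List.take_append_drop _ _).symm
    · apply List.ne_nil_of_length_pos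
      rw [List.length_take]
      omega
    · apply List.ne_nil_of_length_pos
      rw [List.length_drop]
      omega

lemma IsLexical.lexLt_of_append {p s : List ℕ} (h : IsLexical (p ++ s)) (hp : p ≠ [])
    (hs : s ≠ []) : lexLt s (p ++ s) :=
  (isLexical_iff.1 h).2 p s hp hs rfl

lemma lexLt_seqE_append_of_odd_prefix {τ ζ p r : List ℕ} (hτ : IsLexical τ) (hζ : ζ ≠ [])
    (hlex : IsLexical (seqE τ ++ ζ)) (hp : Odd p.length) (hr : r ≠ [])
    (h : seqO τ ++ ζ = p ++ r) : lexLt r (seqE τ ++ ζ) := by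
  have hτne : τ ≠ [] := hτ.1.1
  have hpne : p ≠ [] := by
    rintro rfl
    simp at hp
  have hEne : seqE τ ≠ [] := by
    obtain ⟨a, x, rfl⟩ := List.exists_cons_of_ne_nil hτne
    simp
  rcases lt_or_ge p.length τ.length with hlt | hge
  · -- `p` is a proper left sequence of `τ`
    have hsplit : τ = τ.take p.length ++ τ.drop p.length := (List.take_append_drop _ _).symm
    have hlen : (τ.take p.length).length = p.length := by
      rw [List.length_take]
      omega
    set q := τ.take p.length
    set ω := τ.drop p.length with hω
    have hωne : ω ≠ [] := by
      apply List.ne_nil_of_length_pos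
      rw [hω, List.length_drop]
      omega
    have hO : seqO τ = q ++ seqE ω := by
      conv_lhs => rw [hsplit]
      exact seqO_append_of_odd (hlen ▸ hp) hωne
    rw [hO, List.append_assoc] at h
    obtain ⟨-, rfl⟩ := List.append_inj h hlen
    have hqne : q ≠ [] := List.ne_nil_of_length_pos (by rw [hlen]; exact hp.pos)
    have hωτ : lexLt ω τ := (isLexical_iff.1 hτ).2 q ω hqne hωne hsplit
    refine (lexLt_seqE_seqE_of_length_lt ζ ζ hτ.1.2 ?_).1 hωne hωτ
    rw [hω, List.length_drop]
    have := hp.pos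
    omega
  · have hle : (seqO τ).length ≤ p.length := by
      rcases Nat.even_or_odd τ.length with he | ho
      · rw [length_seqO_of_even he]
        rcases hge.eq_or_lt with heq | hlt
        · rw [← heq] at hp
          exact absurd he (Nat.not_even_iff_odd.2 hp)
        · exact hlt
      · rwa [length_seqO_of_odd ho]
    obtain ⟨ξ, hξ⟩ := List.prefix_of_prefix_length_le ⟨ζ, h⟩ (List.prefix_append p r) hle
    have hζ' : ζ = ξ ++ r := by
      rw [← hξ, List.append_assoc] at h
      exact List.append_cancel_left h
    subst hζ'
    rw [← List.append_assoc] at hlex ⊢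
    exact hlex.lexLt_of_append (by simp [hEne]) hr

lemma eq_append_of_seqO_eq_append {g p c : List ℕ} (hc : c ≠ []) (h : seqO g = p ++ c) :
    ∃ t, g = p ++ t ∧ (Even p.length ∧ c = seqO t ∨ Odd p.length ∧ t ≠ [] ∧ c = seqE t) := by
  have hcl := List.length_pos_iff.2 hc
  have hlen : (seqO g).length = p.length + c.length := by rw [h, List.length_append]
  have hsplit : g = g.take p.length ++ g.drop p.length := (List.take_append_drop _ _).symm
  have hple : p.length ≤ g.length := by
    rcases Nat.even_or_odd g.length with he | ho
    · rw [length_seqO_of_even he] at hlen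
      omega
    · rw [length_seqO_of_odd ho] at hlen
      omega
  have hql : (g.take p.length).length = p.length := by
    rw [List.length_take]
    omega
  set q := g.take p.length
  set t := g.drop p.length with ht
  rw [hsplit] at h
  rcases Nat.even_or_odd p.length with he | ho
  · rw [seqO_append_of_even (hql ▸ he)] at h
    obtain ⟨hqp, hct⟩ := List.append_inj h hql
    exact ⟨t, hqp ▸ hsplit, Or.inl ⟨he, hct.symm⟩⟩
  · have htne : t ≠ [] := by
      apply List.ne_nil_of_length_pos
      rw [ht, List.length_drop]
      rcases Nat.even_or_odd g.length with he' | ho'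
      · have : p.length ≠ g.length := fun heq =>
          Nat.not_even_iff_odd.2 ho (heq ▸ he')
        omega
      · rw [length_seqO_of_odd ho'] at hlen
        omega
    rw [seqO_append_of_odd (hql ▸ ho) htne] at h
    obtain ⟨hqp, hct⟩ := List.append_inj h hql
    exact ⟨t, hqp ▸ hsplit, Or.inr ⟨ho, htne, hct.symm⟩⟩

theorem isLexical_seqO_append {τ ζ : List ℕ} (hτ : IsLexical τ) (hζ : IsAlphaSeq ζ)
    (hg : IsLexical (seqO τ ++ ζ)) (hlex : IsLexical (seqE τ ++ ζ)) :
    IsLexical (seqO (seqO τ ++ ζ) ++ (seqE τ ++ ζ)) := by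
  have hlt : lexLt (seqE τ ++ ζ) (seqO (seqO τ ++ ζ) ++ (seqE τ ++ ζ)) := by
    rw [seqO_append_of_odd (odd_length_seqO τ) hζ.1, List.append_assoc]
    exact lexLt_seqE_seqO hτ.1.1 _ _
  have hprefix := fun p r => lexLt_seqE_append_of_odd_prefix (p := p) (r := r) hτ hζ.1 hlex
  generalize seqO τ ++ ζ = g at hg hlt hprefix ⊢
  generalize seqE τ ++ ζ = k at hlex hlt hprefix ⊢
  refine isLexical_iff.2 ⟨⟨by simp [hlex.1.1], fun a ha => ?_⟩, fun p s hp hs h => ?_⟩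
  · exact (List.mem_append.1 ha).elim (forall_pos_seqO hg.1.2 a) (hlex.1.2 a)
  by_cases hsk : s = k
  · rwa [hsk]
  rcases List.append_eq_append_iff.1 h with ⟨c, rfl, rfl⟩ | ⟨c, hgc, rfl⟩
  · have hc : c ≠ [] := by
      rintro rfl
      simp at hsk
    exact lexLt_trans (hlex.lexLt_of_append hc hs) hlt
  · have hc : c ≠ [] := by
      rintro rfl
      simp at hsk
    obtain ⟨t, rfl, ⟨he, rfl⟩ | ⟨-, htne, rfl⟩⟩ := eq_append_of_seqO_eq_append hc hgc
    · have htpos : ∀ a ∈ t, 0 < a := fun a ha => hg.1.2 a (by simp [ha])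
      have htg : lexLt t (p ++ t) := by
        rcases eq_or_ne t [] with rfl | htne
        · obtain ⟨a, x, rfl⟩ := List.exists_cons_of_ne_nil hp
          exact lexLt_nil_cons (hg.1.2 a (by simp)) _
        · exact hg.lexLt_of_append hp htne
      rcases (lexLt_seqO_seqO_or_prefix k htpos hg.1.2).1 htg with h' | ⟨r, hr⟩
      · exact h'
      · have hrne : r ≠ [] := by
          rintro rfl
          have hl := congrArg List.length hr
          simp only [List.append_nil, List.length_append] at hl
          have hpl := List.length_pos_iff.2 hp
          rcases Nat.even_or_odd t.length with ht | ht
          · rw [length_seqO_of_even ht] at hl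
            obtain ⟨n, hn⟩ := he
            omega
          · rw [length_seqO_of_odd ht] at hl
            omega
        rw [hr, seqO_append_of_odd (odd_length_seqO t) hrne, List.append_assoc]
        refine (lexLt_append_left _).2 (odd_length_seqO t) ?_
        have hrpos : ∀ a ∈ r, 0 < a := fun a ha => hg.1.2 a (by rw [hr]; simp [ha])
        exact (lexLt_seqE_append_and_seqO_append k hrpos hlex.1.2).1 hrne
          (hprefix _ r (odd_length_seqO t) hrne hr)
    · have htpos : ∀ a ∈ t, 0 < a := fun a ha => hg.1.2 a (by simp [ha])
      have hEpos : ∀ a ∈ seqE t ++ k, 0 < a := by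
        obtain ⟨a, x, rfl⟩ := List.exists_cons_of_ne_nil htne
        intro b hb
        rcases List.mem_append.1 hb with hb | hb
        · rw [seqE_cons, List.mem_cons] at hb
          rcases hb with rfl | hb
          · exact htpos b (by simp)
          · exact forall_pos_seqO (fun c hc => htpos c (by simp [hc])) b hb
        · exact hlex.1.2 b hb
      exact (lexLt_seqE_append_and_seqO_append k hg.1.2 hEpos).2
        ((lexLt_seqE_append_and_seqO_append k htpos hg.1.2).1 htne
          (hg.lexLt_of_append hp htne))

/-- if `g = τ_o ζ ∈ L_m` is not least in `L_m`, `τ ∈ L_{m₁}` with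
`m₁ ∤ m`, and `ĝ = τ_e ζ` is lexical, then `g_o ĝ ∈ L_{2m}`. -/
theorem stmt_10 (m m₁ : ℕ) (hm : 2 ≤ m) (hm₁ : 2 ≤ m₁) (hnd : ¬ m₁ ∣ m)
    (τ : List ℕ) (hτ : τ ∈ Lset m₁) (ζ : List ℕ) (hζ : IsAlphaSeq ζ)
    (g : List ℕ) (hgdef : g = seqO τ ++ ζ) (hg : g ∈ Lset m)
    (hnotleast : ¬ LeastIn (Lset m) g)
    (ghat : List ℕ) (hghat : ghat = seqE τ ++ ζ) (hlex : IsLexical ghat) :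
    seqO g ++ ghat ∈ Lset (2 * m) := by
  subst hgdef hghat
  obtain ⟨hτl, -⟩ := hτ
  obtain ⟨hgl, hgs⟩ := hg
  have hsum : (seqO (seqO τ ++ ζ) ++ (seqE τ ++ ζ)).sum = 2 * (τ.sum + 1 + ζ.sum) + 1 := by
    simp only [List.sum_append, sum_seqO, sum_seqE]
    ring
  have hgs' : 1 + (τ.sum + 1 + ζ.sum) = m := by
    rw [← hgs, List.sum_append, sum_seqO]
  refine ⟨isLexical_seqO_append hτl hζ hgl hlex, ?_⟩
  omega
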